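/- Let f(A₀, A₁) be the two-layer in-context loss f(A₀,A₁) = E[tr(∏_{i=1}^{0}(I + X^⊤ A_i X M) X^⊤ X ∏_{j=0}^{1}(I + M X^⊤ A_j X))], with columns of X i.i.d. N(0, I_d). If (A₀*, A₁*) is a global minimizer over symmetric matrices, then there exists a global minimizer in which both matrices are diagonal. -/

import Mathlib

open MeasureTheory ProbabilityTheory Matrix

/-- The mask matrix `M = diag(I_n, 0)`. -/
noncomputable def maskM (n : ℕ) : Matrix (Fin (n + 1)) (Fin (n + 1)) ℝ :=
  Matrix.diagonal fun i => if i = Fin.last n then (0 : ℝ) else 1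

/-- The two-layer in-context loss
`f(A₀,A₁) = E[tr((I + Xᵀ A₁ X M)(I + Xᵀ A₀ X M) Xᵀ X (I + M Xᵀ A₀ X)(I + M Xᵀ A₁ X))]`,
where the columns of `X ∈ ℝ^{d×(n+1)}` are i.i.d. standard Gaussian. -/
noncomputable def iclTwoLayerLoss (d n : ℕ) (A₀ A₁ : Matrix (Fin d) (Fin d) ℝ) : ℝ :=
  ∫ Xc : Fin (n + 1) → Fin d → ℝ,
    (fun Xm : Matrix (Fin d) (Fin (n + 1)) ℝ =>
        Matrix.trace ((1 + Xmᵀ * A₁ * Xm * maskM n) * (1 + Xmᵀ * A₀ * Xm * maskM n) *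
          (Xmᵀ * Xm) * (1 + maskM n * Xmᵀ * A₀ * Xm) * (1 + maskM n * Xmᵀ * A₁ * Xm)))
      (Matrix.of fun i j => Xc j i)
    ∂(Measure.pi fun _ : Fin (n + 1) => Measure.pi fun _ : Fin d => gaussianReal 0 1)

/-- The random integrand of the loss, as a function of the data matrix. -/
noncomputable def iclPt {d n : ℕ} (A₀ A₁ : Matrix (Fin d) (Fin d) ℝ)
    (Xm : Matrix (Fin d) (Fin (n + 1)) ℝ) : ℝ :=
  Matrix.trace ((1 + Xmᵀ * A₁ * Xm * maskM n) * (1 + Xmᵀ * A₀ * Xm * maskM n) *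
          (Xmᵀ * Xm) * (1 + maskM n * Xmᵀ * A₀ * Xm) * (1 + maskM n * Xmᵀ * A₁ * Xm))

/-- The Gaussian law of the columns. -/
noncomputable def iclMu (d n : ℕ) : Measure (Fin (n + 1) → Fin d → ℝ) :=
  Measure.pi fun _ : Fin (n + 1) => Measure.pi fun _ : Fin d => gaussianReal 0 1

instance (d n : ℕ) : IsProbabilityMeasure (iclMu d n) := by
  unfold iclMu; infer_instance

/-- The data matrix. -/
def iclX {d n : ℕ} (Xc : Fin (n + 1) → Fin d → ℝ) : Matrix (Fin d) (Fin (n + 1)) ℝ :=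
  Matrix.of fun i j => Xc j i

lemma loss_eq (d n : ℕ) (A₀ A₁ : Matrix (Fin d) (Fin d) ℝ) :
    iclTwoLayerLoss d n A₀ A₁ = ∫ Xc, iclPt A₀ A₁ (iclX Xc) ∂(iclMu d n) := rfl

/-- Random matrices with all moments finite. -/
def GoodM {Ω a b : Type*} [MeasurableSpace Ω] (μ : Measure Ω) (F : Ω → Matrix a b ℝ) : Prop :=
  ∀ i j, ∀ p : NNReal, MemLp (fun x => F x i j) p μ

section Good
variable {Ω a b c : Type*} [MeasurableSpace Ω] {μ : Measure Ω} [IsProbabilityMeasure μ]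

lemma memLp_mul_all {f g : Ω → ℝ} (hf : ∀ p : NNReal, MemLp f p μ)
    (hg : ∀ p : NNReal, MemLp g p μ) (p : NNReal) : MemLp (fun x => f x * g x) p μ := by
  have h : ENNReal.HolderTriple ((2 * p : NNReal) : ENNReal) ((2 * p : NNReal) : ENNReal) p := by
    constructor
    rw [ENNReal.coe_mul, ENNReal.mul_inv (by simp) (by simp), ← add_mul]
    simp [ENNReal.inv_two_add_inv_two]
  exact MemLp.mul' (hg (2 * p)) (hf (2 * p))

lemma GoodM.const (A : Matrix a b ℝ) : GoodM μ (fun _ => A) :=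
  fun _ _ _ => memLp_const _

lemma GoodM.add {F G : Ω → Matrix a b ℝ} (hF : GoodM μ F) (hG : GoodM μ G) :
    GoodM μ (fun x => F x + G x) := fun i j p => (hF i j p).add (hG i j p)

lemma GoodM.transpose {F : Ω → Matrix a b ℝ} (hF : GoodM μ F) :
    GoodM μ (fun x => (F x)ᵀ) := fun i j p => hF j i p

lemma GoodM.mul [Fintype b] {F : Ω → Matrix a b ℝ} {G : Ω → Matrix b c ℝ} (hF : GoodM μ F)
    (hG : GoodM μ G) : GoodM μ (fun x => F x * G x) := fun i j p => by
  simp only [Matrix.mul_apply]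
  exact memLp_finset_sum _ fun k _ => memLp_mul_all (hF i k) (hG k j) p

lemma GoodM.trace [Fintype a] {F : Ω → Matrix a a ℝ} (hF : GoodM μ F) :
    Integrable (fun x => (F x).trace) μ := by
  simp only [Matrix.trace, Matrix.diag]
  exact integrable_finset_sum _ fun k _ => memLp_one_iff_integrable.1 (by simpa using hF k k 1)
end Good

lemma good_X (d n : ℕ) : GoodM (iclMu d n) (iclX (d := d) (n := n)) := fun i j p => by
  have h1 : MeasurePreserving (fun x : Fin d → ℝ => x i)
      (Measure.pi fun _ : Fin d => gaussianReal 0 1) (gaussianReal 0 1) :=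
    measurePreserving_eval (fun _ : Fin d => gaussianReal 0 1) i
  have h2 : MeasurePreserving (fun x : Fin (n + 1) → Fin d → ℝ => x j)
      (iclMu d n) (Measure.pi fun _ : Fin d => gaussianReal 0 1) :=
    measurePreserving_eval
      (fun _ : Fin (n + 1) => Measure.pi fun _ : Fin d => gaussianReal 0 1) j
  exact (memLp_id_gaussianReal p).comp_measurePreserving (h1.comp h2)

lemma integrable_pt {d n : ℕ} (A₀ A₁ : Matrix (Fin d) (Fin d) ℝ) :
    Integrable (fun Xc => iclPt A₀ A₁ (iclX Xc)) (iclMu d n) := by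
  have hX := good_X d n
  have h1 : ∀ A : Matrix (Fin d) (Fin d) ℝ, GoodM (iclMu d n)
      (fun x => 1 + (iclX x)ᵀ * A * iclX x * maskM n) := fun A =>
    (GoodM.const _).add (((hX.transpose.mul (.const A)).mul hX).mul (.const _))
  have h2 : ∀ A : Matrix (Fin d) (Fin d) ℝ, GoodM (iclMu d n)
      (fun x => 1 + maskM n * (iclX x)ᵀ * A * iclX x) := fun A =>
    (GoodM.const _).add ((((GoodM.const _).mul hX.transpose).mul (.const A)).mul hX)
  exact ((((h1 A₁).mul (h1 A₀)).mul (hX.transpose.mul hX)).mul (h2 A₀)).mul (h2 A₁) |>.trace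

lemma gauss_rot {d : ℕ} (U : Matrix (Fin d) (Fin d) ℝ) (hU : Uᵀ * U = 1) :
    MeasurePreserving (fun x : Fin d → ℝ => U *ᵥ x)
      (Measure.pi fun _ : Fin d => gaussianReal 0 1)
      (Measure.pi fun _ : Fin d => gaussianReal 0 1) := by
  have hmeas : Measurable (fun x : Fin d → ℝ => U *ᵥ x) := by
    refine Continuous.measurable ?_
    fun_prop
  refine ⟨hmeas, ?_⟩
  let L : EuclideanSpace ℝ (Fin d) →ₗᵢ[ℝ] EuclideanSpace ℝ (Fin d) :=
    { toLinearMap := Matrix.toEuclideanLin U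
      norm_map' := fun x => by
        rw [EuclideanSpace.norm_eq, EuclideanSpace.norm_eq]
        congr 1
        have : (U *ᵥ x.ofLp) ⬝ᵥ (U *ᵥ x.ofLp) = x.ofLp ⬝ᵥ x.ofLp := by
          rw [Matrix.dotProduct_mulVec, ← Matrix.mulVec_transpose, Matrix.mulVec_mulVec, hU,
            Matrix.one_mulVec]
        simpa [dotProduct, sq, Matrix.toLpLin_apply] using this }
  have h := stdGaussian_map (L.toLinearIsometryEquiv rfl)
  rw [← map_pi_eq_stdGaussian, Measure.map_map (by fun_prop) (by fun_prop)] at h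
  have h' := congrArg (Measure.map (fun x : EuclideanSpace ℝ (Fin d) => x.ofLp)) h
  rw [Measure.map_map (by fun_prop) (by fun_prop), Measure.map_map (by fun_prop) (by fun_prop)] at h'
  have e2 : ((fun x : EuclideanSpace ℝ (Fin d) => x.ofLp) ∘ (WithLp.toLp 2)) = id := rfl
  rw [e2, Measure.map_id] at h'
  exact h'

lemma mu_rot {d n : ℕ} (U : Matrix (Fin d) (Fin d) ℝ) (hU : Uᵀ * U = 1) :
    MeasurePreserving (fun (x : Fin (n + 1) → Fin d → ℝ) j => U *ᵥ x j)
      (iclMu d n) (iclMu d n) :=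
  measurePreserving_pi _ _ fun _ => gauss_rot U hU

lemma pt_rot {d n : ℕ} (U A₀ A₁ : Matrix (Fin d) (Fin d) ℝ) (hU : Uᵀ * U = 1)
    (X : Matrix (Fin d) (Fin (n + 1)) ℝ) :
    iclPt A₀ A₁ (U * X) = iclPt (Uᵀ * A₀ * U) (Uᵀ * A₁ * U) X := by
  have h : (U * X)ᵀ * (U * X) = Xᵀ * X := by
    rw [Matrix.transpose_mul, Matrix.mul_assoc, ← Matrix.mul_assoc Uᵀ, hU, Matrix.one_mul]
  unfold iclPt
  rw [h]
  simp only [Matrix.transpose_mul, Matrix.mul_assoc]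

lemma loss_rot {d n : ℕ} (U A₀ A₁ : Matrix (Fin d) (Fin d) ℝ) (hU : Uᵀ * U = 1) :
    iclTwoLayerLoss d n (Uᵀ * A₀ * U) (Uᵀ * A₁ * U) = iclTwoLayerLoss d n A₀ A₁ := by
  have hm := mu_rot (n := n) U hU
  rw [loss_eq, loss_eq]
  conv_rhs => rw [← hm.map_eq]
  rw [integral_map hm.aemeasurable (by rw [hm.map_eq]; exact (integrable_pt _ _).1)]
  refine integral_congr_ae (Filter.Eventually.of_forall fun x => ?_)
  exact (pt_rot U A₀ A₁ hU (iclX x)).symm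

lemma trace_convex {a b : Type*} [Fintype a] [Fintype b] (P Q : Matrix a b ℝ) :
    (((1 / 2 : ℝ) • (P + Q))ᵀ * ((1 / 2 : ℝ) • (P + Q))).trace ≤
      (1 / 2) * ((Pᵀ * P).trace + (Qᵀ * Q).trace) := by
  simp only [Matrix.trace, Matrix.diag, Matrix.mul_apply, Matrix.transpose_apply,
    Matrix.smul_apply, Matrix.add_apply, smul_eq_mul, ← Finset.sum_add_distrib, Finset.mul_sum]
  refine Finset.sum_le_sum fun i _ => Finset.sum_le_sum fun j _ => ?_
  nlinarith [sq_nonneg (P j i - Q j i)]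

lemma pt_eq {d n : ℕ} (A₀ A₁ : Matrix (Fin d) (Fin d) ℝ) (h₀ : A₀.IsSymm) (h₁ : A₁.IsSymm)
    (X : Matrix (Fin d) (Fin (n + 1)) ℝ) :
    iclPt A₀ A₁ X = ((X * (1 + maskM n * Xᵀ * A₀ * X) * (1 + maskM n * Xᵀ * A₁ * X))ᵀ *
      (X * (1 + maskM n * Xᵀ * A₀ * X) * (1 + maskM n * Xᵀ * A₁ * X))).trace := by
  have hM : (maskM n)ᵀ = maskM n := Matrix.diagonal_transpose _
  unfold iclPt
  simp only [Matrix.transpose_mul, Matrix.transpose_add, Matrix.transpose_one, hM, h₀.eq, h₁.eq,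
    Matrix.transpose_transpose, Matrix.mul_assoc]

lemma pt_convex {d n : ℕ} (A₀ A B : Matrix (Fin d) (Fin d) ℝ) (h₀ : A₀.IsSymm) (hA : A.IsSymm)
    (hB : B.IsSymm) (X : Matrix (Fin d) (Fin (n + 1)) ℝ) :
    iclPt A₀ ((1 / 2 : ℝ) • (A + B)) X ≤ (1 / 2) * (iclPt A₀ A X + iclPt A₀ B X) := by
  rw [pt_eq A₀ A h₀ hA, pt_eq A₀ B h₀ hB, pt_eq A₀ _ h₀ ((hA.add hB).smul _)]
  refine le_trans (le_of_eq ?_) (trace_convex _ _)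
  have : X * (1 + maskM n * Xᵀ * A₀ * X) * (1 + maskM n * Xᵀ * ((1 / 2 : ℝ) • (A + B)) * X) =
      (1 / 2 : ℝ) • (X * (1 + maskM n * Xᵀ * A₀ * X) * (1 + maskM n * Xᵀ * A * X) +
        X * (1 + maskM n * Xᵀ * A₀ * X) * (1 + maskM n * Xᵀ * B * X)) := by
    rw [← Matrix.mul_add, ← Matrix.mul_smul]
    congr 1
    simp only [Matrix.mul_smul, Matrix.smul_mul, Matrix.mul_add, Matrix.add_mul, smul_add]
    module
  rw [this]

lemma loss_convex {d n : ℕ} (A₀ A B : Matrix (Fin d) (Fin d) ℝ) (h₀ : A₀.IsSymm) (hA : A.IsSymm)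
    (hB : B.IsSymm) :
    iclTwoLayerLoss d n A₀ ((1 / 2 : ℝ) • (A + B)) ≤
      (1 / 2) * (iclTwoLayerLoss d n A₀ A + iclTwoLayerLoss d n A₀ B) := by
  simp only [loss_eq]
  rw [← integral_add (integrable_pt _ _) (integrable_pt _ _), ← integral_const_mul]
  exact integral_mono (integrable_pt _ _)
    (((integrable_pt _ _).add (integrable_pt _ _)).const_mul _)
    fun x => pt_convex A₀ A B h₀ hA hB _

lemma exists_diag {d n : ℕ} (v : Fin d → ℝ) (A : Matrix (Fin d) (Fin d) ℝ) (hA : A.IsSymm)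
    (s : Finset (Fin d)) :
    ∃ B : Matrix (Fin d) (Fin d) ℝ, B.IsSymm ∧
      iclTwoLayerLoss d n (diagonal v) B ≤ iclTwoLayerLoss d n (diagonal v) A ∧
      ∀ i ∈ s, ∀ j, i ≠ j → B i j = 0 := by
  induction s using Finset.induction_on with
  | empty => exact ⟨A, hA, le_rfl, by simp⟩
  | insert k s hk ih =>
    obtain ⟨B, hB, hle, hz⟩ := ih
    let e : Fin d → ℝ := fun i => if i = k then -1 else 1
    have he : ∀ i, e i * e i = 1 := fun i => by simp only [e]; split_ifs <;> norm_num
    have hU : (diagonal e)ᵀ * diagonal e = 1 := by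
      rw [diagonal_transpose, diagonal_mul_diagonal]
      simp [he]
    let C := (diagonal e)ᵀ * B * diagonal e
    have hC : ∀ i j, C i j = e i * B i j * e j := fun i j => by
      simp [C, diagonal_transpose, Matrix.mul_diagonal, Matrix.diagonal_mul]
    have hCs : C.IsSymm := Matrix.IsSymm.ext fun i j => by
      rw [hC, hC, hB.apply]; ring
    have hv : (diagonal e)ᵀ * diagonal v * diagonal e = diagonal v := by
      rw [diagonal_transpose, diagonal_mul_diagonal, diagonal_mul_diagonal]
      congr 1; funext i
      linear_combination v i * he i
    have hl : iclTwoLayerLoss d n (diagonal v) C = iclTwoLayerLoss d n (diagonal v) B := by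
      have := loss_rot (n := n) (diagonal e) (diagonal v) B hU
      rwa [hv] at this
    refine ⟨(1 / 2 : ℝ) • (B + C), (hB.add hCs).smul _, ?_, ?_⟩
    · have := loss_convex (n := n) (diagonal v) B C (Matrix.isSymm_diagonal v) hB hCs
      linarith
    · intro i hi j hij
      rw [Matrix.smul_apply, Matrix.add_apply, hC]
      rcases Finset.mem_insert.1 hi with rfl | hi
      · simp [e, hij.symm]
      · simp [hz i hi j hij]

/-- If `(A₀*, A₁*)` is a global minimizer of the two-layer in-context loss over
symmetric matrices, then there exists a global minimizer in which both matrices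
are diagonal. -/
theorem stmt18 (d n : ℕ) (A₀s A₁s : Matrix (Fin d) (Fin d) ℝ)
    (hsym₀ : A₀s.IsSymm) (hsym₁ : A₁s.IsSymm)
    (hmin : ∀ B₀ B₁ : Matrix (Fin d) (Fin d) ℝ, B₀.IsSymm → B₁.IsSymm →
      iclTwoLayerLoss d n A₀s A₁s ≤ iclTwoLayerLoss d n B₀ B₁) :
    ∃ D₀ D₁ : Matrix (Fin d) (Fin d) ℝ, D₀.IsDiag ∧ D₁.IsDiag ∧
      ∀ B₀ B₁ : Matrix (Fin d) (Fin d) ℝ, B₀.IsSymm → B₁.IsSymm →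
        iclTwoLayerLoss d n D₀ D₁ ≤ iclTwoLayerLoss d n B₀ B₁ := by
  have hH : A₀s.IsHermitian := by
    rw [Matrix.IsHermitian, Matrix.conjTranspose_eq_transpose_of_trivial]; exact hsym₀
  obtain ⟨U, v, hU, hUv⟩ : ∃ (U : Matrix (Fin d) (Fin d) ℝ) (v : Fin d → ℝ), Uᵀ * U = 1 ∧
      Uᵀ * A₀s * U = diagonal v := by
    refine ⟨hH.eigenvectorUnitary, hH.eigenvalues, ?_, ?_⟩
    · have := Unitary.coe_star_mul_self hH.eigenvectorUnitary
      rwa [Matrix.star_eq_conjTranspose, Matrix.conjTranspose_eq_transpose_of_trivial] at this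
    · have := hH.conjStarAlgAut_star_eigenvectorUnitary
      rw [Unitary.conjStarAlgAut_star_apply, Matrix.star_eq_conjTranspose,
        Matrix.conjTranspose_eq_transpose_of_trivial] at this
      exact this
  have hs : (Uᵀ * A₁s * U).IsSymm := by
    rw [Matrix.IsSymm]
    simp [Matrix.transpose_mul, hsym₁.eq, Matrix.mul_assoc]
  obtain ⟨B, _, hle, hz⟩ := exists_diag (n := n) v _ hs Finset.univ
  refine ⟨diagonal v, B, Matrix.isDiag_diagonal v, fun i j hij => hz i (Finset.mem_univ _) j hij, ?_⟩
  intro B₀ B₁ h₀ h₁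
  have h := loss_rot (n := n) U A₀s A₁s hU
  rw [hUv] at h
  exact hle.trans (h.le.trans (hmin B₀ B₁ h₀ h₁))
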